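/- arXiv:2305.08519 — 9 statements merged into one kernel-verified Lean document; each statement's English description precedes it below -/
import Mathlib

section
/- Let G be a graph on vertex set {1,...,n} with adjacency matrix A, and let x ∈ Δₙ. If there exist two distinct reals c₁ ≠ c₂ with x ∈ gKKT_{c₁}(G) and x ∈ gKKT_{c₂}(G), then x is the characteristic vector of its support S = supp(x) (i.e., xᵢ = 1/|S| for all i ∈ S) and the induced subgraph G[S] is regular. -/
open Matrix BigOperators

/-- The characteristic vector of a non-empty set `S` of vertices: `1/|S|` on `S`, `0` elsewhere. -/
noncomputable def charVec {n : ℕ} (S : Finset (Fin n)) : Fin n → ℝ :=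
  fun i => if i ∈ S then ((S.card : ℝ))⁻¹ else 0

/-- The set of generalized KKT points of the parametric Motzkin–Straus program. -/
def gKKT {n : ℕ} (A : Matrix (Fin n) (Fin n) ℝ) (c : ℝ) : Set (Fin n → ℝ) :=
  {x | x ∈ stdSimplex ℝ (Fin n) ∧
    ∃ lam : ℝ, ∀ i, x i ≠ 0 → ((A + c • 1) *ᵥ x) i = lam}

/-- A vector with coordinate sum `1` that is constant on its support is a characteristic vector. -/
theorem eq_charVec_of_constant_on_support {n : ℕ} {x : Fin n → ℝ} {t : ℝ}
    (hx : ∑ i, x i = 1) (ht : ∀ i, x i ≠ 0 → x i = t) :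
    x = charVec (Finset.univ.filter (fun i => x i ≠ 0)) := by
  have hcard : ((Finset.univ.filter (fun i => x i ≠ 0)).card : ℝ) * t = 1 := by
    rw [← hx, ← Finset.sum_filter_ne_zero, ← nsmul_eq_mul, ← Finset.sum_const]
    exact Finset.sum_congr rfl fun i hi => (ht i (Finset.mem_filter.mp hi).2).symm
  funext i
  by_cases hi : x i = 0
  · simp [charVec, hi]
  · rw [charVec, if_pos (by simpa using hi), ht i hi]
    exact eq_inv_of_mul_eq_one_right hcard

/-- For a 0-1 matrix and a vector constant on its support, matrix-vector multiplication
counts neighbors inside the support. -/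
theorem mulVec_eq_card_mul {n : ℕ} {A : Matrix (Fin n) (Fin n) ℝ} {x : Fin n → ℝ} {t : ℝ}
    (h01 : ∀ i j, A i j = 0 ∨ A i j = 1) (ht : ∀ i, x i ≠ 0 → x i = t) (i : Fin n) :
    (A *ᵥ x) i =
      (((Finset.univ.filter (fun i => x i ≠ 0)).filter (fun j => A i j = 1)).card : ℝ) * t := by
  rw [← nsmul_eq_mul, ← Finset.sum_const, Finset.sum_filter, Finset.sum_filter,
    mulVec, dotProduct]
  refine Finset.sum_congr rfl fun j _ => ?_
  by_cases hj : x j = 0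
  · simp [hj]
  · rcases h01 i j with h | h <;> simp [h, ht j hj]

/-- A generalized KKT point for two distinct values of the parameter is a
characteristic vector, and the subgraph induced by its support is regular. -/
theorem gkkt_two_params_charVec
    (n : ℕ) (A : Matrix (Fin n) (Fin n) ℝ)
    (hsymm : A.IsSymm)
    (h01 : ∀ i j, A i j = 0 ∨ A i j = 1)
    (hdiag : ∀ i, A i i = 0)
    (x : Fin n → ℝ) (c₁ c₂ : ℝ) (hc : c₁ ≠ c₂)
    (h₁ : x ∈ gKKT A c₁) (h₂ : x ∈ gKKT A c₂) :
    x = charVec (Finset.univ.filter (fun i => x i ≠ 0)) ∧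
      ∃ d : ℕ, ∀ i ∈ Finset.univ.filter (fun i => x i ≠ 0),
        ((Finset.univ.filter (fun i => x i ≠ 0)).filter (fun j => A i j = 1)).card = d := by
  obtain ⟨⟨-, hsum⟩, l₁, hl₁⟩ := h₁
  obtain ⟨-, l₂, hl₂⟩ := h₂
  simp only [add_mulVec, smul_mulVec, one_mulVec, Pi.add_apply, Pi.smul_apply,
    smul_eq_mul] at hl₁ hl₂
  have hc' : c₁ - c₂ ≠ 0 := sub_ne_zero.mpr hc
  have ht : ∀ i, x i ≠ 0 → x i = (l₁ - l₂) / (c₁ - c₂) := fun i hi => by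
    rw [eq_div_iff hc']
    linarith [hl₁ i hi, hl₂ i hi]
  refine ⟨eq_charVec_of_constant_on_support hsum ht, ?_⟩
  obtain ⟨k, -, hk⟩ : ∃ k ∈ Finset.univ, x k ≠ 0 :=
    Finset.exists_ne_zero_of_sum_ne_zero (by rw [hsum]; exact one_ne_zero)
  refine ⟨((Finset.univ.filter (fun i => x i ≠ 0)).filter (fun j => A k j = 1)).card,
    fun i hi => ?_⟩
  replace hi : x i ≠ 0 := (Finset.mem_filter.mp hi).2
  have hik := (hl₁ i hi).trans (hl₁ k hk).symm
  rw [ht i hi, ht k hk, add_left_inj, mulVec_eq_card_mul h01 ht, mulVec_eq_card_mul h01 ht] at hik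
  exact_mod_cast mul_right_cancel₀ (ht k hk ▸ hk) hik
end

section
/- Let G be a graph on vertex set {1,...,n} with adjacency matrix A, let c ∈ ℝ, let x ∈ gKKT_c(G) with support S = supp(x), and let 𝒢 be a finite group of automorphisms of the induced subgraph G[S] (permutations σ of S with i ~ j iff σ(i) ~ σ(j) for all i, j ∈ S). Then there exists a point x̂ ∈ gKKT_c(G) with supp(x̂) = S and x̂_{σ(i)} = x̂_i for every i ∈ S and every σ ∈ 𝒢. -/
open Matrix BigOperators

/-- If `A` is invariant under `σ` on pairs of indices in the support of `x ∘ σ`, then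
`(A + c • 1) *ᵥ (x ∘ σ)` at `i` is `(A + c • 1) *ᵥ x` at `σ i`. -/
lemma add_smul_one_mulVec_comp_perm {ι : Type*} [Fintype ι] [DecidableEq ι]
    (A : Matrix ι ι ℝ) (c : ℝ) (x : ι → ℝ) (σ : Equiv.Perm ι) (i : ι)
    (h : ∀ j, x (σ j) ≠ 0 → A i j = A (σ i) (σ j)) :
    ((A + c • 1) *ᵥ (x ∘ σ)) i = ((A + c • 1) *ᵥ x) (σ i) := by
  simp only [mulVec, dotProduct]
  rw [← Equiv.sum_comp σ (fun j => (A + c • (1 : Matrix ι ι ℝ)) (σ i) j * x j)]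
  refine Finset.sum_congr rfl fun j _ => ?_
  by_cases hj : x (σ j) = 0
  · simp [hj]
  · simp [h j hj, Matrix.one_apply]

/-- Given a generalized KKT point `x` with support `S` and a group `𝒢` of
automorphisms of the induced subgraph `G[S]`, there is a generalized KKT point `x̂` with the
same support which is invariant under every automorphism in `𝒢`. -/
theorem gkkt_symmetrization
    (n : ℕ) (A : Matrix (Fin n) (Fin n) ℝ) (c : ℝ)
    (hsymm : A.IsSymm)
    (h01 : ∀ i j, A i j = 0 ∨ A i j = 1)
    (hdiag : ∀ i, A i i = 0)
    (x : Fin n → ℝ) (hx : x ∈ gKKT A c)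
    (𝒢 : Subgroup (Equiv.Perm (Fin n)))
    (hmaps : ∀ σ ∈ 𝒢, ∀ i, x i ≠ 0 → x (σ i) ≠ 0)
    (hauto : ∀ σ ∈ 𝒢, ∀ i j, x i ≠ 0 → x j ≠ 0 →
      (A i j = 1 ↔ A (σ i) (σ j) = 1)) :
    ∃ xh ∈ gKKT A c, (∀ i, xh i ≠ 0 ↔ x i ≠ 0) ∧
      ∀ σ ∈ 𝒢, ∀ i, x i ≠ 0 → xh (σ i) = xh i := by
  classical
  obtain ⟨⟨hx0, hx1⟩, lam, hlam⟩ := hx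
  have hsupp : ∀ σ ∈ 𝒢, ∀ i, x (σ i) ≠ 0 ↔ x i ≠ 0 := fun σ hσ i =>
    ⟨fun h => by simpa using hmaps σ⁻¹ (𝒢.inv_mem hσ) (σ i) h, hmaps σ hσ i⟩
  have hcard : (0 : ℝ) < Fintype.card 𝒢 := by exact_mod_cast Fintype.card_pos
  set N : ℝ := (Fintype.card 𝒢 : ℝ) with hN
  let xh : Fin n → ℝ := N⁻¹ • ∑ σ : 𝒢, x ∘ σ.1
  have hxh : ∀ i, xh i = N⁻¹ * ∑ σ : 𝒢, x (σ.1 i) := fun i => by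
    simp [xh, Finset.sum_apply]
  have hxh_supp : ∀ i, xh i ≠ 0 ↔ x i ≠ 0 := by
    intro i
    rw [hxh, Ne, mul_eq_zero, not_or, Finset.sum_eq_zero_iff_of_nonneg fun σ _ => hx0 _]
    constructor
    · rintro ⟨-, h⟩ hi
      exact h fun σ _ => not_not.1 fun h' => (hsupp σ.1 σ.2 i).1 h' hi
    · exact fun hi => ⟨inv_ne_zero hcard.ne', fun h => hi (h 1 (Finset.mem_univ _))⟩
  refine ⟨xh, ⟨⟨fun i => ?_, ?_⟩, lam, fun i hi => ?_⟩, hxh_supp, fun σ hσ i _ => ?_⟩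
  · rw [hxh]
    exact mul_nonneg (inv_nonneg.2 hcard.le) (Finset.sum_nonneg fun σ _ => hx0 _)
  · simp_rw [hxh]
    rw [← Finset.mul_sum, Finset.sum_comm]
    simp_rw [Equiv.sum_comp _ x, hx1]
    simp [← hN, hcard.ne']
  · have hi' := (hxh_supp i).1 hi
    have hσ : ∀ σ : 𝒢, ((A + c • 1) *ᵥ (x ∘ σ.1)) i = lam := by
      intro σ
      rw [add_smul_one_mulVec_comp_perm, hlam _ (hmaps σ.1 σ.2 i hi')]
      intro j hj
      have h := hauto σ.1 σ.2 i j hi' ((hsupp σ.1 σ.2 j).1 hj)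
      rcases h01 i j with h₁ | h₁ <;> rcases h01 (σ.1 i) (σ.1 j) with h₂ | h₂ <;> simp_all
    simp only [xh, mulVec_smul, mulVec_sum, Pi.smul_apply, Finset.sum_apply, hσ]
    simp [← hN, hcard.ne']
  · rw [hxh, hxh, ← Equiv.sum_comp (Equiv.mulRight (⟨σ, hσ⟩ : 𝒢)) fun τ => x (τ.1 i)]
    simp
end

section
/- Let G be a graph on vertex set {1,...,n}. Suppose there are three distinct vertices i₁, i₂, i₃ with i₁ not adjacent to i₃, i₂ adjacent to i₃, and i₁ adjacent to i₂. Let S' ⊆ {1,...,n} be such that every vertex in S' adjacent to i₁ is also adjacent to i₂, and set S = S' ∪ {i₁, i₂, i₃}. Then no element of gKKT₁(G) has support equal to S. -/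
open Matrix BigOperators

/-- If `i₁ ≁ i₃`, `i₂ ∼ i₃`, `i₁ ∼ i₂`, and every vertex of `S'` adjacent to
`i₁` is also adjacent to `i₂`, then no element of `gKKT₁(G)` has support `S' ∪ {i₁, i₂, i₃}`. -/
theorem no_gkkt_support_cherry_adjacent
    (n : ℕ) (A : Matrix (Fin n) (Fin n) ℝ)
    (hsymm : A.IsSymm)
    (h01 : ∀ i j, A i j = 0 ∨ A i j = 1)
    (hdiag : ∀ i, A i i = 0)
    (i₁ i₂ i₃ : Fin n) (h12 : i₁ ≠ i₂) (h13 : i₁ ≠ i₃) (h23 : i₂ ≠ i₃)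
    (hni13 : A i₁ i₃ = 0) (ha23 : A i₂ i₃ = 1) (ha12 : A i₁ i₂ = 1)
    (S' : Set (Fin n)) (hS' : ∀ j ∈ S', A i₁ j = 1 → A i₂ j = 1) :
    ¬ ∃ x ∈ gKKT A 1, {i | x i ≠ 0} = S' ∪ {i₁, i₂, i₃} := by
  rintro ⟨x, ⟨⟨hx0, -⟩, lam, hlam⟩, hsupp⟩
  have hmem : ∀ i, x i ≠ 0 ↔ i ∈ S' ∪ {i₁, i₂, i₃} := fun i => Set.ext_iff.mp hsupp i
  have hx1 : x i₁ ≠ 0 := (hmem i₁).2 (by simp)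
  have hx2 : x i₂ ≠ 0 := (hmem i₂).2 (by simp)
  have hx3 : x i₃ ≠ 0 := (hmem i₃).2 (by simp)
  have ha21 : A i₂ i₁ = 1 := hsymm.apply i₁ i₂ ▸ ha12
  have hlt : ((A + (1 : ℝ) • 1) *ᵥ x) i₁ < ((A + (1 : ℝ) • 1) *ᵥ x) i₂ := by
    simp only [mulVec, dotProduct]
    refine Finset.sum_lt_sum (fun j _ => ?_) ⟨i₃, Finset.mem_univ _, ?_⟩
    · by_cases hj : x j = 0
      · simp [hj]
      refine mul_le_mul_of_nonneg_right ?_ (hx0 j)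
      simp only [Matrix.add_apply, one_smul]
      by_cases hj1 : j = i₁
      · subst hj1
        simp [hdiag, ha21, h12.symm]
      by_cases hj2 : j = i₂
      · subst hj2
        simp [hdiag, ha12, h12]
      rw [one_apply_ne (Ne.symm hj1), one_apply_ne (Ne.symm hj2), add_zero, add_zero]
      by_cases hj3 : j = i₃
      · subst hj3
        simp [hni13, ha23]
      have hjS : j ∈ S' := by simpa [hj1, hj2, hj3] using (hmem j).1 hj
      rcases h01 i₁ j with h | h
      · rcases h01 i₂ j with h' | h' <;> simp [h, h']
      · rw [h, hS' j hjS h]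
    · have := lt_of_le_of_ne (hx0 i₃) hx3.symm
      simpa [hni13, ha23, h13, h23] using this
  exact hlt.ne ((hlam i₁ hx1).trans (hlam i₂ hx2).symm)
end

section
/- Let G be a graph on vertex set {1,...,n}. Suppose there are three distinct vertices i₁, i₂, i₃ with i₁ not adjacent to i₃, i₂ adjacent to i₃, and i₁ not adjacent to i₂. Let S' ⊆ {1,...,n} be such that every vertex in S' adjacent to i₁ is also adjacent to i₂, and set S = S' ∪ {i₁, i₂, i₃}. Then no element of gKKT₀(G) has support equal to S. -/
open Matrix BigOperators

/-- **STATEMENT 7.** If `i₁ ≁ i₃`, `i₂ ∼ i₃`, `i₁ ≁ i₂`, and every vertex of `S'` adjacent to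
`i₁` is also adjacent to `i₂`, then no element of `gKKT₀(G)` has support `S' ∪ {i₁, i₂, i₃}`. -/
theorem no_gkkt_support_cherry_nonadjacent
    (n : ℕ) (A : Matrix (Fin n) (Fin n) ℝ)
    (hsymm : A.IsSymm)
    (h01 : ∀ i j, A i j = 0 ∨ A i j = 1)
    (hdiag : ∀ i, A i i = 0)
    (i₁ i₂ i₃ : Fin n) (h12 : i₁ ≠ i₂) (h13 : i₁ ≠ i₃) (h23 : i₂ ≠ i₃)
    (hni13 : A i₁ i₃ = 0) (ha23 : A i₂ i₃ = 1) (ha12 : A i₁ i₂ = 0)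
    (S' : Set (Fin n)) (hS' : ∀ j ∈ S', A i₁ j = 1 → A i₂ j = 1) :
    ¬ ∃ x ∈ gKKT A 0, {i | x i ≠ 0} = S' ∪ {i₁, i₂, i₃} := by
  rintro ⟨x, ⟨⟨hx0, -⟩, lam, hlam⟩, hsupp⟩
  have hmem (j : Fin n) : x j ≠ 0 ↔ j ∈ S' ∪ {i₁, i₂, i₃} := Set.ext_iff.mp hsupp j
  have hx1 : x i₁ ≠ 0 := (hmem i₁).2 (by simp)
  have hx2 : x i₂ ≠ 0 := (hmem i₂).2 (by simp)
  have hx3 : x i₃ ≠ 0 := (hmem i₃).2 (by simp)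
  have hrow : (A *ᵥ x) i₁ = (A *ᵥ x) i₂ := by
    simpa using (hlam i₁ hx1).trans (hlam i₂ hx2).symm
  refine hrow.not_lt (Finset.sum_lt_sum (fun j _ => ?_) ⟨i₃, Finset.mem_univ _, ?_⟩)
  · by_cases hj : x j = 0
    · simp [hj]
    · refine mul_le_mul_of_nonneg_right ?_ (hx0 j)
      have h2 : 0 ≤ A i₂ j := by rcases h01 i₂ j with h | h <;> simp [h]
      rcases h01 i₁ j with h | h
      · exact h.trans_le h2
      · rcases (hmem j).1 hj with hS | rfl | rfl | rfl
        · exact (h.trans (hS' j hS h).symm).le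
        · simp [hdiag] at h
        · simp [ha12] at h
        · simp [hni13] at h
  · simpa [hni13, ha23] using lt_of_le_of_ne (hx0 i₃) hx3.symm
end

section
/- Let G be a graph on vertex set {1,...,n} and let S ⊆ {1,...,n} be non-empty. Then there exists a bounded interval I ⊂ ℝ such that for every c ∈ ℝ \ I there is at least one element of gKKT_c(G) whose support equals S. -/
open Matrix BigOperators

/-- A small perturbation `1 + t • B` of the identity matrix maps some entrywise positive vector
to a constant vector. -/
theorem eventually_exists_pos_mulVec_eq_const {ι : Type*} [Fintype ι] [DecidableEq ι]
    (B : Matrix ι ι ℝ) :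
    ∀ᶠ t : ℝ in nhds 0, ∃ z : ι → ℝ, (∀ i, 0 < z i) ∧
      ∃ d : ℝ, ∀ i, z i + t * (B *ᵥ z) i = d := by
  have hcont : Continuous fun t : ℝ => (1 + t • B).adjugate *ᵥ (fun _ => (1 : ℝ)) :=
    Continuous.matrix_mulVec (Continuous.matrix_adjugate (by fun_prop)) continuous_const
  have hpos : ∀ᶠ t : ℝ in nhds 0,
      ∀ i, 0 < ((1 + t • B).adjugate *ᵥ (fun _ => (1 : ℝ))) i := by
    refine Filter.eventually_all.2 fun i => ?_
    refine ((continuous_apply i).comp hcont).continuousAt.eventually_const_lt ?_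
    simp
  filter_upwards [hpos] with t ht
  refine ⟨_, ht, (1 + t • B).det, fun i => ?_⟩
  have h : (1 + t • B) *ᵥ ((1 + t • B).adjugate *ᵥ (fun _ => (1 : ℝ))) =
      (1 + t • B).det • (fun _ => (1 : ℝ)) := by
    rw [mulVec_mulVec, mul_adjugate, smul_mulVec, one_mulVec]
  simpa [-mulVec_mulVec, add_mulVec (1 : Matrix ι ι ℝ), smul_mulVec] using congrFun h i

/-- For every non-empty set `S` of vertices there is a bounded interval `I`
such that for every `c` outside `I` some generalized KKT point has support exactly `S`. -/
theorem gkkt_support_outside_interval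
    (n : ℕ) (A : Matrix (Fin n) (Fin n) ℝ)
    (hsymm : A.IsSymm)
    (h01 : ∀ i j, A i j = 0 ∨ A i j = 1)
    (hdiag : ∀ i, A i i = 0)
    (S : Finset (Fin n)) (hS : S.Nonempty) :
    ∃ a b : ℝ, ∀ c : ℝ, c ∉ Set.Icc a b →
      ∃ x ∈ gKKT A c, {i | x i ≠ 0} = ↑S := by
  obtain ⟨δ, hδ, hball⟩ := Metric.eventually_nhds_iff.1
    (eventually_exists_pos_mulVec_eq_const
      (A * diagonal fun i => if i ∈ S then (1 : ℝ) else 0))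
  refine ⟨-δ⁻¹, δ⁻¹, fun c hc => ?_⟩
  have hc' : δ⁻¹ < |c| := by
    rw [Set.mem_Icc, ← abs_le] at hc
    exact not_le.1 hc
  have hc0 : c ≠ 0 := abs_pos.1 ((inv_pos.2 hδ).trans hc')
  obtain ⟨z, hz, d, hd⟩ := @hball c⁻¹ (by
    rw [Real.dist_eq, sub_zero, abs_inv]
    exact inv_lt_of_inv_lt₀ hδ hc')
  set w : Fin n → ℝ := fun i => if i ∈ S then z i else 0 with hw
  have hBw : (A * diagonal fun i => if i ∈ S then (1 : ℝ) else 0) *ᵥ z = A *ᵥ w := by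
    rw [← mulVec_mulVec]
    congr 1
    ext i
    simp [mulVec_diagonal, hw]
  have hw0 : ∀ i, 0 ≤ w i := fun i => by
    by_cases hi : i ∈ S <;> simp [hw, hi, (hz i).le]
  have hs : 0 < ∑ i, w i := by
    obtain ⟨k, hk⟩ := hS
    exact Finset.sum_pos' (fun i _ => hw0 i) ⟨k, Finset.mem_univ k, by simp [hw, hk, hz k]⟩
  have hsupp : ∀ i, w i ≠ 0 ↔ i ∈ S := fun i => by
    simp [hw, (hz i).ne']
  refine ⟨(∑ i, w i)⁻¹ • w, ⟨⟨fun i => ?_, ?_⟩, (∑ i, w i)⁻¹ * (c * d), fun i hi => ?_⟩, ?_⟩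
  · exact mul_nonneg (inv_nonneg.2 hs.le) (hw0 i)
  · simp [← Finset.mul_sum, hs.ne']
  · have hiS : i ∈ S := (hsupp i).1 (right_ne_zero_of_mul hi)
    have hwi : w i = z i := by simp [hw, hiS]
    have hdi := hd i
    rw [hBw, ← hwi] at hdi
    rw [mulVec_smul, add_mulVec, smul_mulVec, one_mulVec, ← hdi]
    simp only [Pi.smul_apply, Pi.add_apply, smul_eq_mul]
    field_simp
    ring
  · ext i
    simp [hs.ne', hsupp]
end

section
/- Let G be a graph on vertex set {1,...,n} with adjacency matrix A, let c ∈ ℝ, let x ∈ gKKT_c(G), and set S = supp(x). Suppose −c is not an eigenvalue of the principal submatrix A[S,S] (the submatrix of A with rows and columns indexed by S). Then for every automorphism σ of the induced subgraph G[S] and every i ∈ S one has x_{σ(i)} = x_i; that is, every class of the partition of S into level sets {i ∈ S : xᵢ = t} is invariant under every automorphism of G[S]. -/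
open Matrix BigOperators

/-- Let `x` be a generalized KKT point with support `S` and suppose `-c` is
not an eigenvalue of the principal submatrix `A[S,S]` (stated here as: every vector `v`
supported on `S` with `(Av)ᵢ = -c·vᵢ` on `S` is zero). Then `x` is invariant under every
automorphism of `G[S]`: every level class of `x` is invariant. -/
theorem gkkt_invariant_under_automorphisms
    (n : ℕ) (A : Matrix (Fin n) (Fin n) ℝ) (c : ℝ)
    (hsymm : A.IsSymm)
    (h01 : ∀ i j, A i j = 0 ∨ A i j = 1)
    (hdiag : ∀ i, A i i = 0)
    (x : Fin n → ℝ) (hx : x ∈ gKKT A c)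
    (heig : ∀ v : Fin n → ℝ, (∀ i, x i = 0 → v i = 0) →
      (∀ i, x i ≠ 0 → (A *ᵥ v) i = -c * v i) → v = 0) :
    ∀ σ : Equiv.Perm (Fin n),
      (∀ i, x i ≠ 0 → x (σ i) ≠ 0) →
      (∀ i j, x i ≠ 0 → x j ≠ 0 → (A i j = 1 ↔ A (σ i) (σ j) = 1)) →
      ∀ i, x i ≠ 0 → x (σ i) = x i := by
  intro σ hσ hadj i hi
  obtain ⟨-, lam, hlam⟩ := hx
  have hσ_zero : ∀ j, x j = 0 → x (σ j) = 0 := by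
    intro j hj
    by_contra hne
    have := Equiv.Perm.perm_symm_on_of_perm_on_finite (f := σ) (p := fun k => x k ≠ 0) hσ hne
    exact this (by simpa using hj)
  have hmul : ∀ k, x k ≠ 0 → (A *ᵥ x) k = lam - c * x k := by
    intro k hk
    have := hlam k hk
    simp only [Matrix.add_mulVec, Matrix.smul_mulVec, Matrix.one_mulVec, Pi.add_apply,
      Pi.smul_apply, smul_eq_mul] at this
    linarith
  have hcomp : ∀ k, x k ≠ 0 → (A *ᵥ (x ∘ σ)) k = (A *ᵥ x) (σ k) := by
    intro k hk
    simp only [Matrix.mulVec, dotProduct, Function.comp_apply]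
    rw [← Equiv.sum_comp σ (fun j => A (σ k) j * x j)]
    refine Finset.sum_congr rfl fun j _ => ?_
    by_cases hj : x j = 0
    · simp [hσ_zero j hj]
    · have := hadj k j hk hj
      rcases h01 k j with h | h <;> rcases h01 (σ k) (σ j) with h' | h' <;>
        simp [h, h'] at this ⊢
  have hzero : x ∘ σ - x = 0 := by
    refine heig _ (fun k hk => by simp [hk, hσ_zero k hk]) fun k hk => ?_
    rw [Matrix.mulVec_sub, Pi.sub_apply, hcomp k hk, hmul k hk, hmul _ (hσ k hk)]
    simp only [Pi.sub_apply, Function.comp_apply]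
    ring
  exact sub_eq_zero.mp (congrFun hzero i)
end

section
/- Let V₁, V₂, ..., V_k be pairwise disjoint non-empty subsets of {1,...,n}, with characteristic vectors x^{V₁},...,x^{V_k} ∈ Δₙ. Then the convex hull of {x^{V₁},...,x^{V_k}} equals the intersection of the standard simplex Δₙ with the linear span of {x^{V₁},...,x^{V_k}}. -/
open Matrix BigOperators

theorem sum_charVec {n : ℕ} {S : Finset (Fin n)} (hS : S.Nonempty) :
    ∑ i, charVec S i = 1 := by
  have hcard : (S.card : ℝ) ≠ 0 := by exact_mod_cast hS.card_pos.ne'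
  simp [charVec, hcard]

theorem charVec_mem_stdSimplex {n : ℕ} {S : Finset (Fin n)} (hS : S.Nonempty) :
    charVec S ∈ stdSimplex ℝ (Fin n) := by
  refine ⟨fun i => ?_, sum_charVec hS⟩
  unfold charVec
  split_ifs <;> positivity

/-- On the block `V ℓ`, a combination of characteristic vectors of disjoint sets only sees the
coefficient of `V ℓ`. -/
theorem sum_smul_charVec_apply {n k : ℕ} {V : Fin k → Finset (Fin n)}
    (hdisj : ∀ ℓ m, ℓ ≠ m → Disjoint (V ℓ) (V m)) (c : Fin k → ℝ) {ℓ : Fin k} {i : Fin n}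
    (hi : i ∈ V ℓ) :
    (∑ m, c m • charVec (V m)) i = c ℓ * ((V ℓ).card : ℝ)⁻¹ := by
  rw [Finset.sum_apply, Finset.sum_eq_single ℓ]
  · simp [charVec, hi]
  · intro m _ hm
    have : i ∉ V m := Finset.disjoint_left.mp (hdisj ℓ m hm.symm) hi
    simp [charVec, this]
  · simp

/-- For pairwise disjoint non-empty sets `V₁, …, V_k` of vertices, the convex
hull of their characteristic vectors equals the intersection of the standard simplex with
their linear span. -/
theorem convexHull_charVec_eq_simplex_inter_span
    (n k : ℕ) (V : Fin k → Finset (Fin n))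
    (hne : ∀ ℓ, (V ℓ).Nonempty)
    (hdisj : ∀ ℓ m, ℓ ≠ m → Disjoint (V ℓ) (V m)) :
    convexHull ℝ (Set.range fun ℓ => charVec (V ℓ)) =
      stdSimplex ℝ (Fin n) ∩ ↑(Submodule.span ℝ (Set.range fun ℓ => charVec (V ℓ))) := by
  apply Set.Subset.antisymm
  · refine Set.subset_inter (convexHull_min ?_ (convex_stdSimplex ℝ (Fin n)))
      (convexHull_min Submodule.subset_span (Submodule.convex _))
    rintro _ ⟨ℓ, rfl⟩
    exact charVec_mem_stdSimplex (hne ℓ)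
  · rintro x ⟨⟨hx_nonneg, hx_sum⟩, hx_span⟩
    obtain ⟨c, rfl⟩ := (Submodule.mem_span_range_iff_exists_fun ℝ).mp hx_span
    refine (convex_convexHull ℝ _).sum_mem (fun ℓ _ => ?_) ?_
      fun ℓ _ => subset_convexHull ℝ _ (Set.mem_range_self ℓ)
    · obtain ⟨i, hi⟩ := hne ℓ
      have hcard : (0 : ℝ) < (V ℓ).card := by exact_mod_cast (hne ℓ).card_pos
      have h := hx_nonneg i
      rw [sum_smul_charVec_apply hdisj c hi] at h
      exact nonneg_of_mul_nonneg_left h (inv_pos.mpr hcard)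
    · rw [← hx_sum]
      simp only [Finset.sum_apply, Pi.smul_apply, smul_eq_mul]
      rw [Finset.sum_comm]
      simp [← Finset.mul_sum, sum_charVec (hne _)]
end

section
/- Let G be a graph on vertex set {1,...,n} with adjacency matrix A, let c ∈ ℝ, let x ∈ gKKT_c(G), let 𝒫 = {V₁,...,V_k} be a partition of supp(x) that separates distinct values of x, let D ∈ ℝ^{k×k} be the density matrix with entries d_{ℓm} = d_G(V_ℓ, V_m), let Λ = diag(|V₁|,...,|V_k|), and let y ∈ Δ_k be the barycentric coordinates of x with respect to 𝒫. Then y has full support and there exists λ ∈ ℝ such that ((D + cΛ⁻¹)y)_ℓ = λ for every ℓ ∈ {1,...,k}; that is, y is a KKT point for the program max{yᵀ(D + cΛ⁻¹)y : y ∈ relint(Δ_k)}. -/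
open Matrix BigOperators

/-- `e_G(S₁,S₂)`: the number of ordered pairs of adjacent vertices in `S₁ × S₂`. -/
noncomputable def eG {n : ℕ} (A : Matrix (Fin n) (Fin n) ℝ) (S₁ S₂ : Finset (Fin n)) : ℕ :=
  ((S₁ ×ˢ S₂).filter (fun p => A p.1 p.2 = 1)).card

/-- The edge density `d_G(S₁,S₂) = e_G(S₁,S₂)/(|S₁||S₂|)`. -/
noncomputable def dG {n : ℕ} (A : Matrix (Fin n) (Fin n) ℝ) (S₁ S₂ : Finset (Fin n)) : ℝ :=
  (eG A S₁ S₂ : ℝ) / ((S₁.card : ℝ) * (S₂.card : ℝ))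

/-- The number of adjacent pairs is the sum of the corresponding entries of a 0-1 matrix. -/
theorem eG_eq_sum {n : ℕ} {A : Matrix (Fin n) (Fin n) ℝ} (h01 : ∀ i j, A i j = 0 ∨ A i j = 1)
    (S T : Finset (Fin n)) : (eG A S T : ℝ) = ∑ i ∈ S, ∑ j ∈ T, A i j := by
  rw [eG, Finset.card_filter, Nat.cast_sum, Finset.sum_product]
  refine Finset.sum_congr rfl fun i _ => Finset.sum_congr rfl fun j _ => ?_
  rcases h01 i j with h | h <;> simp [h]

theorem mulVec_charVec {n : ℕ} (A : Matrix (Fin n) (Fin n) ℝ) (T : Finset (Fin n)) (i : Fin n) :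
    (A *ᵥ charVec T) i = (∑ j ∈ T, A i j) * (T.card : ℝ)⁻¹ := by
  simp [Matrix.mulVec, dotProduct, charVec, Finset.sum_mul]

/-- The edge density is the average over `S` of the image of the characteristic vector of `T`. -/
theorem dG_eq_average {n : ℕ} {A : Matrix (Fin n) (Fin n) ℝ}
    (h01 : ∀ i j, A i j = 0 ∨ A i j = 1) (S T : Finset (Fin n)) :
    dG A S T = (S.card : ℝ)⁻¹ * ∑ i ∈ S, (A *ᵥ charVec T) i := by
  simp only [dG, eG_eq_sum h01, mulVec_charVec, ← Finset.sum_mul, div_eq_mul_inv, mul_inv]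
  ring

/-- On a class of a family of disjoint sets, a combination of characteristic vectors has the
coefficient of that class divided by its size as its value. -/
theorem sum_mul_charVec_of_mem {n k : ℕ} {V : Fin k → Finset (Fin n)}
    (hdisj : ∀ ℓ m, ℓ ≠ m → Disjoint (V ℓ) (V m)) (y : Fin k → ℝ) {ℓ : Fin k} {i : Fin n}
    (hi : i ∈ V ℓ) : ∑ m, y m * charVec (V m) i = y ℓ * ((V ℓ).card : ℝ)⁻¹ := by
  rw [Finset.sum_eq_single ℓ]
  · simp [charVec, hi]
  · intro m _ hm
    simp [charVec, Finset.disjoint_left.mp (hdisj ℓ m hm.symm) hi]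
  · simp

/-- The density matrix acts on coefficients by averaging over the classes. -/
theorem density_mulVec {n k : ℕ} {A : Matrix (Fin n) (Fin n) ℝ}
    (h01 : ∀ i j, A i j = 0 ∨ A i j = 1) (V : Fin k → Finset (Fin n)) (y : Fin k → ℝ)
    (ℓ : Fin k) :
    ((Matrix.of fun ℓ' m => dG A (V ℓ') (V m)) *ᵥ y) ℓ =
      ((V ℓ).card : ℝ)⁻¹ *
        ∑ i ∈ V ℓ, (A *ᵥ fun j => ∑ m, y m * charVec (V m) j) i := by
  have hlin : (fun j => ∑ m, y m * charVec (V m) j) = ∑ m, y m • charVec (V m) := by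
    ext j
    simp
  simp only [hlin, Matrix.mulVec_sum, Matrix.mulVec_smul, Finset.sum_apply, Pi.smul_apply,
    smul_eq_mul]
  rw [Finset.sum_comm, Finset.mul_sum]
  change ∑ m, dG A (V ℓ) (V m) * y m = _
  refine Finset.sum_congr rfl fun m _ => ?_
  rw [dG_eq_average h01, ← Finset.mul_sum]
  ring

/-- If `x` is a generalized KKT point and `𝒫 = {V₁,…,V_k}` is a partition of
`supp(x)` separating distinct values of `x`, then the barycentric coordinates `y` of `x` have
full support and form a KKT point for the reduced program on `relint(Δ_k)` with matrix
`D + cΛ⁻¹`. -/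
theorem barycentric_of_gkkt_is_kkt
    (n : ℕ) (A : Matrix (Fin n) (Fin n) ℝ) (c : ℝ)
    (hsymm : A.IsSymm)
    (h01 : ∀ i j, A i j = 0 ∨ A i j = 1)
    (hdiag : ∀ i, A i i = 0)
    (x : Fin n → ℝ) (hx : x ∈ gKKT A c)
    (k : ℕ) (V : Fin k → Finset (Fin n))
    (hne : ∀ ℓ, (V ℓ).Nonempty)
    (hdisj : ∀ ℓ m, ℓ ≠ m → Disjoint (V ℓ) (V m))
    (hcover : Finset.univ.biUnion V = Finset.univ.filter (fun i => x i ≠ 0))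
    (hsep : ∀ ℓ, ∀ i ∈ V ℓ, ∀ j ∈ V ℓ, x i = x j)
    (y : Fin k → ℝ) (hy : y ∈ stdSimplex ℝ (Fin k))
    (hxy : x = fun i => ∑ ℓ, y ℓ * charVec (V ℓ) i) :
    (∀ ℓ, y ℓ ≠ 0) ∧
      ∃ lam : ℝ, ∀ ℓ,
        (((Matrix.of fun ℓ' m => dG A (V ℓ') (V m)) +
            c • Matrix.diagonal (fun ℓ' => (((V ℓ').card : ℝ))⁻¹)) *ᵥ y) ℓ = lam := by
  have hval : ∀ ℓ, ∀ i ∈ V ℓ, x i = y ℓ * ((V ℓ).card : ℝ)⁻¹ := fun ℓ i hi => by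
    rw [hxy]
    exact sum_mul_charVec_of_mem hdisj y hi
  have hsupp : ∀ ℓ, ∀ i ∈ V ℓ, x i ≠ 0 := fun ℓ i hi => by
    have hmem : i ∈ Finset.univ.biUnion V := Finset.mem_biUnion.mpr ⟨ℓ, Finset.mem_univ ℓ, hi⟩
    rw [hcover] at hmem
    exact (Finset.mem_filter.mp hmem).2
  refine ⟨fun ℓ hℓ => ?_, ?_⟩
  · obtain ⟨i, hi⟩ := hne ℓ
    exact hsupp ℓ i hi (by rw [hval ℓ i hi, hℓ, zero_mul])
  · obtain ⟨-, lam, hlam⟩ := hx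
    refine ⟨lam, fun ℓ => ?_⟩
    have hcard : ((V ℓ).card : ℝ) ≠ 0 := Nat.cast_ne_zero.mpr (hne ℓ).card_ne_zero
    have hA : ∀ i ∈ V ℓ, (A *ᵥ x) i = lam - c * (y ℓ * ((V ℓ).card : ℝ)⁻¹) := fun i hi => by
      have h := hlam i (hsupp ℓ i hi)
      rw [Matrix.add_mulVec, Matrix.smul_mulVec, Matrix.one_mulVec, Pi.add_apply,
        Pi.smul_apply, smul_eq_mul, hval ℓ i hi] at h
      linarith
    rw [Matrix.add_mulVec, Pi.add_apply, density_mulVec h01, ← hxy, Finset.sum_congr rfl hA,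
      Finset.sum_const, nsmul_eq_mul, inv_mul_cancel_left₀ hcard, Matrix.smul_mulVec,
      Pi.smul_apply, Matrix.mulVec_diagonal, smul_eq_mul]
    ring
end

section
/- Let G be a graph on vertex set {1,...,n} and let H and P be disjoint non-empty subsets of vertices such that: every vertex of H is adjacent to every vertex of P; the induced subgraph G[H] is complete; the induced subgraph G[P] is d-regular but G[H ∪ P] is not complete. Then, with b = |P| − d, one has b > 1, and for every c ∉ [1, b] the set gKKT_c(G) contains a vector with support equal to H ∪ P. -/
open Matrix BigOperators

/-- The vector equal to `u` on `H`, to `v` on `P \ H`, and to `0` elsewhere. -/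
def twoLevel {ι : Type*} [DecidableEq ι] (H P : Finset ι) (u v : ℝ) (i : ι) : ℝ :=
  if i ∈ H then u else if i ∈ P then v else 0

theorem sum_mul_twoLevel {ι : Type*} [Fintype ι] [DecidableEq ι] {H P : Finset ι}
    (hdisj : Disjoint H P) (u v : ℝ) (f : ι → ℝ) :
    ∑ j, f j * twoLevel H P u v j = u * ∑ j ∈ H, f j + v * ∑ j ∈ P, f j := by
  have hpt : ∀ j, f j * twoLevel H P u v j =
      (if j ∈ H then u * f j else 0) + (if j ∈ P then v * f j else 0) := by
    intro j
    by_cases hjH : j ∈ H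
    · simp [twoLevel, hjH, Finset.disjoint_left.mp hdisj hjH, mul_comm]
    · by_cases hjP : j ∈ P <;> simp [twoLevel, hjH, hjP, mul_comm]
  simp_rw [hpt]
  simp [Finset.sum_add_distrib, Finset.mul_sum]

theorem support_twoLevel {ι : Type*} [DecidableEq ι] (H P : Finset ι) {u v : ℝ}
    (hu : u ≠ 0) (hv : v ≠ 0) : {i | twoLevel H P u v i ≠ 0} = ↑(H ∪ P) := by
  ext i
  by_cases hiH : i ∈ H <;> by_cases hiP : i ∈ P <;> simp [twoLevel, hiH, hiP, hu, hv]

theorem sum_row_of_complete {ι : Type*} [DecidableEq ι] {A : Matrix ι ι ℝ} {H : Finset ι}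
    (hdiag : ∀ i, A i i = 0) (hcomplete : ∀ i ∈ H, ∀ j ∈ H, i ≠ j → A i j = 1)
    {i : ι} (hi : i ∈ H) : ∑ j ∈ H, A i j = (H.card : ℝ) - 1 := by
  have hrow : ∀ j ∈ H, A i j = 1 - if i = j then 1 else 0 := by
    intro j hj
    by_cases hij : i = j
    · subst hij
      simp [hdiag]
    · simp [hij, hcomplete i hi j hj hij]
  rw [Finset.sum_congr rfl hrow]
  simp [Finset.sum_sub_distrib, hi]

theorem sum_row_eq_card_filter {ι : Type*} {A : Matrix ι ι ℝ}
    (h01 : ∀ i j, A i j = 0 ∨ A i j = 1) (P : Finset ι) (i : ι) :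
    ∑ j ∈ P, A i j = ((P.filter (fun j => A i j = 1)).card : ℝ) := by
  rw [Finset.card_filter, Nat.cast_sum]
  refine Finset.sum_congr rfl fun j _ => ?_
  rcases h01 i j with h | h <;> simp [h]

theorem card_filter_add_two_le {ι : Type*} [DecidableEq ι] {A : Matrix ι ι ℝ} {P : Finset ι}
    (hdiag : ∀ i, A i i = 0) {i j : ι} (hi : i ∈ P) (hj : j ∈ P) (hij : i ≠ j)
    (hA : A i j ≠ 1) : (P.filter (fun k => A i k = 1)).card + 2 ≤ P.card := by
  have hjF : j ∉ P.filter (fun k => A i k = 1) := by simp [hA]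
  have hiF : i ∉ insert j (P.filter (fun k => A i k = 1)) := by simp [hij, hdiag]
  have hsub : insert i (insert j (P.filter (fun k => A i k = 1))) ⊆ P := by
    simp [Finset.insert_subset_iff, hi, hj]
  have hcard := Finset.card_le_card hsub
  rwa [Finset.card_insert_of_notMem hiF, Finset.card_insert_of_notMem hjF] at hcard

/-- Two-level weights solving the stationarity equation of a generalized star. -/
theorem exists_pos_weights {h p b c : ℝ} (hh : 0 < h) (hp : 0 < p) (hb : 1 < b)
    (hc : c ∉ Set.Icc 1 b) :
    ∃ u v : ℝ, 0 < u ∧ 0 < v ∧ u * h + v * p = 1 ∧ (c - 1) * u = (c - b) * v := by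
  set s := (c - b) * h + (c - 1) * p with hs
  have hpos : 0 < (c - b) / s ∧ 0 < (c - 1) / s := by
    by_cases h1 : 1 ≤ c
    · have h2 : b < c := lt_of_not_ge fun h => hc ⟨h1, h⟩
      have hcb : 0 < c - b := by linarith
      have hc1 : 0 < c - 1 := by linarith
      have : 0 < s := by positivity
      exact ⟨by positivity, by positivity⟩
    · have hcb : c - b < 0 := by linarith
      have hc1 : c - 1 < 0 := by linarith
      have : s < 0 := add_neg (mul_neg_of_neg_of_pos hcb hh) (mul_neg_of_neg_of_pos hc1 hp)
      exact ⟨div_pos_of_neg_of_neg hcb this, div_pos_of_neg_of_neg hc1 this⟩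
  have hs0 : s ≠ 0 := by
    intro h
    simp [h] at hpos
  refine ⟨(c - b) / s, (c - 1) / s, hpos.1, hpos.2, ?_, by ring⟩
  rw [div_mul_eq_mul_div, div_mul_eq_mul_div, ← add_div, ← hs, div_self hs0]

/-- Let `G[H ∪ P]` be a generalized star with core `H`: `H` and `P` are
disjoint and non-empty, every vertex of `H` is adjacent to every vertex of `P`, `G[H]` is
complete, `G[P]` is `d`-regular, and `G[H ∪ P]` is not complete. Then `b = |P| - d > 1` and
for every `c ∉ [1, b]` there is a generalized KKT point with support exactly `H ∪ P`. -/
theorem generalized_star_gkkt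
    (n : ℕ) (A : Matrix (Fin n) (Fin n) ℝ)
    (hsymm : A.IsSymm)
    (h01 : ∀ i j, A i j = 0 ∨ A i j = 1)
    (hdiag : ∀ i, A i i = 0)
    (H P : Finset (Fin n)) (hH : H.Nonempty) (hP : P.Nonempty)
    (hdisj : Disjoint H P)
    (hjoin : ∀ i ∈ H, ∀ j ∈ P, A i j = 1)
    (hHcomplete : ∀ i ∈ H, ∀ j ∈ H, i ≠ j → A i j = 1)
    (d : ℕ) (hPreg : ∀ i ∈ P, (P.filter (fun j => A i j = 1)).card = d)
    (hnotcomplete : ¬ ∀ i ∈ H ∪ P, ∀ j ∈ H ∪ P, i ≠ j → A i j = 1) :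
    1 < (P.card : ℝ) - d ∧
      ∀ c : ℝ, c ∉ Set.Icc (1 : ℝ) ((P.card : ℝ) - d) →
        ∃ x ∈ gKKT A c, {i | x i ≠ 0} = ↑(H ∪ P) := by
  have hjoin' : ∀ i ∈ P, ∀ j ∈ H, A i j = 1 := fun i hi j hj => by
    rw [← hsymm.apply]
    exact hjoin j hj i hi
  have hb : 1 < (P.card : ℝ) - d := by
    push Not at hnotcomplete
    obtain ⟨i, hi, j, hj, hij, hA⟩ := hnotcomplete
    rw [Finset.mem_union] at hi hj
    have hiP : i ∈ P := hi.resolve_left fun hiH =>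
      hA (hj.elim (fun hjH => hHcomplete i hiH j hjH hij) (hjoin i hiH j))
    have hjP : j ∈ P := hj.resolve_left fun hjH => hA (hjoin' i hiP j hjH)
    have hcard := card_filter_add_two_le hdiag hiP hjP hij hA
    rw [hPreg i hiP] at hcard
    have : (d : ℝ) + 2 ≤ P.card := by exact_mod_cast hcard
    linarith
  refine ⟨hb, fun c hc => ?_⟩
  obtain ⟨u, v, hu, hv, hsum, hstat⟩ := exists_pos_weights (h := H.card) (p := P.card)
    (by exact_mod_cast hH.card_pos) (by exact_mod_cast hP.card_pos) hb hc
  have hsupp := support_twoLevel H P hu.ne' hv.ne'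
  refine ⟨twoLevel H P u v, ⟨⟨fun i => ?_, ?_⟩, u * (H.card : ℝ) + v * d + c * v, ?_⟩, hsupp⟩
  · unfold twoLevel
    split_ifs <;> simp [hu.le, hv.le]
  · simpa [hsum] using sum_mul_twoLevel hdisj u v fun _ => 1
  · intro i hi
    have hmem : i ∈ H ∪ P := by
      rw [← Finset.mem_coe, ← hsupp]
      exact hi
    have hrow : ((A + c • 1) *ᵥ twoLevel H P u v) i =
        u * ∑ j ∈ H, A i j + v * ∑ j ∈ P, A i j + c * twoLevel H P u v i := by
      rw [← sum_mul_twoLevel hdisj, add_mulVec, smul_mulVec, one_mulVec]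
      rfl
    rw [hrow]
    rcases Finset.mem_union.mp hmem with hiH | hiP
    · rw [sum_row_of_complete hdiag hHcomplete hiH, Finset.sum_congr rfl (hjoin i hiH)]
      simp only [twoLevel, hiH, if_true, Finset.sum_const, nsmul_eq_mul, mul_one]
      linarith
    · have hiH : i ∉ H := Finset.disjoint_right.mp hdisj hiP
      rw [sum_row_eq_card_filter h01 P, hPreg i hiP, Finset.sum_congr rfl (hjoin' i hiP)]
      simp [twoLevel, hiH, hiP]
end
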